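/- arXiv:1512.06485 — 2 statements merged into one kernel-verified Lean document; each statement's English description precedes it below -/
import Mathlib

section
/- The family ψ_1,…,ψ_{4p−4} is completable to a product basis: there exist mn − (4p−4) further product states (each of the form v ⊗ w with v ∈ ℂ^m, w ∈ ℂ^n) which together with ψ_1,…,ψ_{4p−4} form an orthonormal basis of ℂ^m ⊗ ℂ^n. -/
open scoped ComplexInnerProductSpace Kronecker ComplexOrder

/-- The `i`-th standard basis vector `|i⟩` of `ℂ^m` (zero if `i ≥ m`). -/
noncomputable def ket (m i : ℕ) : EuclideanSpace ℂ (Fin m) :=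
  (WithLp.equiv 2 (Fin m → ℂ)).symm fun a => if (a : ℕ) = i then 1 else 0

/-- The product state `v ⊗ w`, with entries `(v ⊗ w)_{(a,b)} = v_a * w_b`. -/
noncomputable def tp {m n : ℕ} (v : EuclideanSpace ℂ (Fin m)) (w : EuclideanSpace ℂ (Fin n)) :
    EuclideanSpace ℂ (Fin m × Fin n) :=
  (WithLp.equiv 2 (Fin m × Fin n → ℂ)).symm fun ab => v ab.1 * w ab.2

/-- The scalar `1/√2`. -/
noncomputable def invSqrt2 : ℂ := ((Real.sqrt 2)⁻¹ : ℝ)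

/-- A matrix on `ℂ^m ⊗ ℂ^n` acting as a linear map. -/
noncomputable def act {m n : ℕ} (M : Matrix (Fin m × Fin n) (Fin m × Fin n) ℂ)
    (x : EuclideanSpace ℂ (Fin m × Fin n)) : EuclideanSpace ℂ (Fin m × Fin n) :=
  Matrix.toEuclideanLin M x

/-- The index `j(i)`: `j(i) = i + 1` for `i ≤ p - 2`, and `j(p-1) = 1`. -/
def jf (p i : ℕ) : ℕ := if i = p - 1 then 1 else i + 1

/-- The `4p-4` product states `ψ_k` (`1 ≤ k ≤ 4p-4`):
`ψ_i = |i⟩ ⊗ (|0⟩-|i⟩)/√2`, `ψ_{i+p-1} = (|0⟩-|i⟩)/√2 ⊗ |j(i)⟩`,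
`ψ_{i+2p-2} = |i⟩ ⊗ (|0⟩+|i⟩)/√2`, `ψ_{i+3p-3} = (|0⟩+|i⟩)/√2 ⊗ |j(i)⟩`, for `1 ≤ i ≤ p-1`. -/
noncomputable def psi (m n p k : ℕ) : EuclideanSpace ℂ (Fin m × Fin n) :=
  if k ≤ p - 1 then tp (ket m k) (invSqrt2 • (ket n 0 - ket n k))
  else if k ≤ 2 * p - 2 then
    tp (invSqrt2 • (ket m 0 - ket m (k - (p - 1)))) (ket n (jf p (k - (p - 1))))
  else if k ≤ 3 * p - 3 then
    tp (ket m (k - (2 * p - 2))) (invSqrt2 • (ket n 0 + ket n (k - (2 * p - 2))))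
  else tp (invSqrt2 • (ket m 0 + ket m (k - (3 * p - 3)))) (ket n (jf p (k - (3 * p - 3))))

theorem inner_tp {m n : ℕ} (v v' : EuclideanSpace ℂ (Fin m)) (w w' : EuclideanSpace ℂ (Fin n)) :
    inner ℂ (tp v w) (tp v' w') = inner ℂ v v' * inner ℂ w w' := by
  simp only [PiLp.inner_apply, tp, RCLike.inner_apply, Fintype.sum_prod_type,
    Finset.sum_mul_sum]
  refine Finset.sum_congr rfl fun a _ => Finset.sum_congr rfl fun b _ => ?_
  simp only [WithLp.equiv_symm_apply, map_mul]
  ring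

theorem inner_ket {m : ℕ} (i j : ℕ) (hi : i < m) :
    inner ℂ (ket m i) (ket m j) = if i = j then 1 else 0 := by
  simp only [PiLp.inner_apply, ket, RCLike.inner_apply, WithLp.equiv_symm_apply]
  rw [Finset.sum_eq_single (⟨i, hi⟩ : Fin m)]
  · simp
  · intro b _ hb
    have : (b : ℕ) ≠ i := fun h => hb (Fin.ext h)
    simp [this]
  · simp

theorem conj_invSqrt2 : (starRingEnd ℂ) invSqrt2 = invSqrt2 := by
  simp only [invSqrt2, Complex.conj_ofReal]

theorem invSqrt2_mul_self : invSqrt2 * invSqrt2 = 1 / 2 := by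
  rw [invSqrt2, ← Complex.ofReal_mul, ← mul_inv, Real.mul_self_sqrt (by norm_num)]
  norm_num

/-- The vector `(|0⟩ + s|i⟩)/√2`. -/
noncomputable def plusKet (m i : ℕ) (s : ℤ) : EuclideanSpace ℂ (Fin m) :=
  invSqrt2 • (ket m 0 + (s : ℂ) • ket m i)

theorem inner_plusKet_plusKet {m i j : ℕ} (s t : ℤ) (hi : 1 ≤ i) (him : i < m) (hj : 1 ≤ j) :
    inner ℂ (plusKet m i s) (plusKet m j t) =
      if i = j then ((1 + s * t) / 2 : ℂ) else 1 / 2 := by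
  have h0 : 0 < m := by omega
  have h1 : i ≠ 0 := by omega
  have h2 : 0 ≠ j := by omega
  simp only [plusKet, inner_smul_left, inner_smul_right, inner_add_left, inner_add_right,
    inner_ket _ _ h0, inner_ket _ _ him, conj_invSqrt2, map_intCast, if_neg h1, if_neg h2, if_true]
  split_ifs
  · linear_combination (1 + (s : ℂ) * t) * invSqrt2_mul_self
  · linear_combination invSqrt2_mul_self

theorem inner_plusKet_ket {m i : ℕ} (s : ℤ) (j : ℕ) (him : i < m) :
    inner ℂ (plusKet m i s) (ket m j) =
      invSqrt2 * ((if 0 = j then 1 else 0) + s * (if i = j then 1 else 0)) := by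
  have h0 : 0 < m := by omega
  simp only [plusKet, inner_smul_left, inner_add_left,
    inner_ket _ _ h0, inner_ket _ _ him, conj_invSqrt2, map_intCast]

theorem inner_ket_plusKet {m j : ℕ} (s : ℤ) (i : ℕ) (hj : j < m) :
    inner ℂ (ket m j) (plusKet m i s) =
      invSqrt2 * ((if j = 0 then 1 else 0) + s * (if j = i then 1 else 0)) := by
  simp only [plusKet, inner_smul_right, inner_add_right, inner_ket _ _ hj]

/-- The state `|i⟩ ⊗ (|0⟩ + s|i⟩)/√2`. -/
noncomputable def rowState (m n i : ℕ) (s : ℤ) : EuclideanSpace ℂ (Fin m × Fin n) :=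
  tp (ket m i) (plusKet n i s)

/-- The state `(|0⟩ + s|i⟩)/√2 ⊗ |j(i)⟩`. -/
noncomputable def colState (m n p i : ℕ) (s : ℤ) : EuclideanSpace ℂ (Fin m × Fin n) :=
  tp (plusKet m i s) (ket n (jf p i))

section

variable {m n p i i' : ℕ}

theorem jf_bounds (h3 : 3 ≤ p) (hi : 1 ≤ i) (hip : i ≤ p - 1) :
    1 ≤ jf p i ∧ jf p i ≤ p - 1 ∧ jf p i ≠ i := by
  unfold jf
  split_ifs <;> omega

theorem jf_inj (hi : 1 ≤ i) (hi' : 1 ≤ i') : jf p i = jf p i' ↔ i = i' := by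
  unfold jf
  split_ifs <;> omega

theorem inner_rowState_rowState (s t : ℤ) (hi : 1 ≤ i) (him : i < m) (hin : i < n)
    (hi' : 1 ≤ i') :
    inner ℂ (rowState m n i s) (rowState m n i' t) =
      if i = i' then ((1 + s * t) / 2 : ℂ) else 0 := by
  rw [rowState, rowState, inner_tp, inner_ket _ _ him, inner_plusKet_plusKet s t hi hin hi']
  split_ifs <;> simp

theorem inner_colState_colState (s t : ℤ) (h3 : 3 ≤ p) (hpm : p ≤ m) (hpn : p ≤ n)
    (hi : 1 ≤ i) (hip : i ≤ p - 1) (hi' : 1 ≤ i') :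
    inner ℂ (colState m n p i s) (colState m n p i' t) =
      if i = i' then ((1 + s * t) / 2 : ℂ) else 0 := by
  have := jf_bounds h3 hi hip
  rw [colState, colState, inner_tp, inner_ket _ _ (by omega),
    inner_plusKet_plusKet s t hi (by omega) hi']
  simp only [jf_inj hi hi']
  split_ifs <;> simp

theorem inner_rowState_colState (s t : ℤ) (h3 : 3 ≤ p) (hpm : p ≤ m) (hpn : p ≤ n)
    (hi : 1 ≤ i) (hip : i ≤ p - 1) (hi' : 1 ≤ i') (hip' : i' ≤ p - 1) :
    inner ℂ (rowState m n i s) (colState m n p i' t) = 0 := by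
  obtain ⟨h1, -, h2⟩ := jf_bounds h3 hi' hip'
  rw [rowState, colState, inner_tp, inner_ket_plusKet _ _ (by omega),
    inner_plusKet_ket _ _ (by omega)]
  have h0 : i ≠ 0 := by omega
  have h0' : 0 ≠ jf p i' := by omega
  by_cases h : i = i'
  · subst h
    simp [h0', h2.symm]
  · simp [h0, h]

end

/-- The cells `(a, b)` on which some `ψ_k` has a nonzero entry. -/
def coveredCells (p : ℕ) : Finset (ℕ × ℕ) :=
  (Finset.Icc 1 (p - 1)).image (fun i => (i, 0)) ∪ (Finset.Icc 1 (p - 1)).image (fun i => (i, i)) ∪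
    ((Finset.Icc 1 (p - 1)).image (fun i => (0, jf p i)) ∪
      (Finset.Icc 1 (p - 1)).image (fun i => (i, jf p i)))

theorem card_coveredCells_le (p : ℕ) : (coveredCells p).card ≤ 4 * p - 4 := by
  have h (f : ℕ → ℕ × ℕ) : ((Finset.Icc 1 (p - 1)).image f).card ≤ p - 1 := by
    simpa using Finset.card_image_le (s := Finset.Icc 1 (p - 1)) (f := f)
  refine (Finset.card_union_le _ _).trans ((add_le_add (Finset.card_union_le _ _)
    (Finset.card_union_le _ _)).trans ?_)
  have h1 := h (fun i => (i, 0))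
  have h2 := h (fun i => (i, i))
  have h3 := h (fun i => (0, jf p i))
  have h4 := h (fun i => (i, jf p i))
  omega

theorem mem_coveredCells {p a b : ℕ} : (a, b) ∈ coveredCells p ↔
    ∃ i, (1 ≤ i ∧ i ≤ p - 1) ∧ (a = i ∧ (b = 0 ∨ b = i ∨ b = jf p i) ∨ a = 0 ∧ b = jf p i) := by
  simp only [coveredCells, Finset.mem_union, Finset.mem_image, Finset.mem_Icc, Prod.mk.injEq]
  constructor
  · rintro ((⟨i, hi, rfl, rfl⟩ | ⟨i, hi, rfl, rfl⟩) | ⟨i, hi, rfl, rfl⟩ | ⟨i, hi, rfl, rfl⟩) <;>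
      exact ⟨i, hi, by simp⟩
  · rintro ⟨i, hi, (⟨rfl, rfl | rfl | rfl⟩ | ⟨rfl, rfl⟩)⟩
    · exact Or.inl (Or.inl ⟨_, hi, rfl, rfl⟩)
    · exact Or.inl (Or.inr ⟨_, hi, rfl, rfl⟩)
    · exact Or.inr (Or.inr ⟨_, hi, rfl, rfl⟩)
    · exact Or.inr (Or.inl ⟨_, hi, rfl, rfl⟩)

theorem exists_uncovered_cells (p m n : ℕ) :
    ∃ c : Fin (m * n - (4 * p - 4)) ↪ Fin m × Fin n,
      ∀ t, (((c t).1 : ℕ), ((c t).2 : ℕ)) ∉ coveredCells p := by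
  let S : Finset (Fin m × Fin n) :=
    Finset.univ.filter fun x => ((x.1 : ℕ), (x.2 : ℕ)) ∈ coveredCells p
  have hS : S.card ≤ 4 * p - 4 := by
    refine le_trans ?_ (card_coveredCells_le p)
    refine Finset.card_le_card_of_injOn (fun x => ((x.1 : ℕ), (x.2 : ℕ))) ?_ ?_
    · intro x hx
      simpa [S] using hx
    · intro x _ y _ h
      simpa [Prod.ext_iff, Fin.ext_iff] using h
  have hc : Fintype.card (Fin (m * n - (4 * p - 4))) ≤ Fintype.card (Sᶜ : Finset _) := by
    rw [Fintype.card_fin, Fintype.card_coe, Finset.card_compl]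
    simp only [Fintype.card_prod, Fintype.card_fin]
    omega
  obtain ⟨e⟩ := Function.Embedding.nonempty_of_card_le hc
  refine ⟨e.trans (Function.Embedding.subtype _), fun t => ?_⟩
  simpa [S] using (e t).2

section

variable {m n p i a b : ℕ}

theorem inner_rowState_ket (s : ℤ) (hi : 1 ≤ i) (hip : i ≤ p - 1) (him : i < m) (hin : i < n)
    (hab : (a, b) ∉ coveredCells p) :
    inner ℂ (rowState m n i s) (tp (ket m a) (ket n b)) = 0 := by
  rw [rowState, inner_tp, inner_ket _ _ him, inner_plusKet_ket _ _ hin]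
  have h : i = a → 0 ≠ b ∧ i ≠ b := by
    rintro rfl
    constructor <;> rintro rfl <;> exact hab (mem_coveredCells.2 ⟨i, ⟨hi, hip⟩, by simp⟩)
  by_cases hia : i = a
  · simp [(h hia).1, (h hia).2]
  · simp [hia]

theorem inner_colState_ket (s : ℤ) (hi : 1 ≤ i) (hip : i ≤ p - 1) (him : i < m)
    (hjn : jf p i < n) (hab : (a, b) ∉ coveredCells p) :
    inner ℂ (colState m n p i s) (tp (ket m a) (ket n b)) = 0 := by
  rw [colState, inner_tp, inner_plusKet_ket _ _ him, inner_ket _ _ hjn]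
  have h : jf p i = b → 0 ≠ a ∧ i ≠ a := by
    rintro rfl
    constructor <;> rintro rfl <;> exact hab (mem_coveredCells.2 ⟨i, ⟨hi, hip⟩, by simp⟩)
  by_cases hib : jf p i = b
  · simp [(h hib).1, (h hib).2]
  · simp [hib]

end

theorem psi_eq_rowState_or_colState (m n p : ℕ) {k : ℕ} (hk : 1 ≤ k) (hkp : k ≤ 4 * p - 4) :
    ∃ i, 1 ≤ i ∧ i ≤ p - 1 ∧
      (k = i ∧ psi m n p k = rowState m n i (-1) ∨
        k = i + (p - 1) ∧ psi m n p k = colState m n p i (-1) ∨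
        k = i + (2 * p - 2) ∧ psi m n p k = rowState m n i 1 ∨
        k = i + (3 * p - 3) ∧ psi m n p k = colState m n p i 1) := by
  unfold psi rowState colState plusKet
  simp only [Int.cast_neg, Int.cast_one, neg_smul, one_smul, ← sub_eq_add_neg]
  split_ifs with h1 h2 h3
  · exact ⟨k, hk, h1, Or.inl ⟨rfl, rfl⟩⟩
  · exact ⟨k - (p - 1), by omega, by omega, Or.inr (Or.inl ⟨by omega, rfl⟩)⟩
  · exact ⟨k - (2 * p - 2), by omega, by omega, Or.inr (Or.inr (Or.inl ⟨by omega, rfl⟩))⟩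
  · exact ⟨k - (3 * p - 3), by omega, by omega, Or.inr (Or.inr (Or.inr ⟨by omega, rfl⟩))⟩

theorem inner_psi_psi {p m n k l : ℕ} (h3 : 3 ≤ p) (hpm : p ≤ m) (hpn : p ≤ n)
    (hk : 1 ≤ k) (hkp : k ≤ 4 * p - 4) (hl : 1 ≤ l) (hlp : l ≤ 4 * p - 4) :
    inner ℂ (psi m n p k) (psi m n p l) = if k = l then 1 else 0 := by
  obtain ⟨i, hi, hip, h⟩ := psi_eq_rowState_or_colState m n p hk hkp
  obtain ⟨j, hj, hjp, h'⟩ := psi_eq_rowState_or_colState m n p hl hlp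
  have hrr (s t : ℤ) := inner_rowState_rowState (m := m) (n := n) (i := i) (i' := j) s t hi
    (by omega) (by omega) hj
  have hcc (s t : ℤ) := inner_colState_colState s t h3 hpm hpn hi hip hj
  have hrc (s t : ℤ) := inner_rowState_colState s t h3 hpm hpn hi hip hj hjp
  have hcr (s t : ℤ) : inner ℂ (colState m n p i s) (rowState m n j t) = 0 :=
    inner_eq_zero_symm.1 (inner_rowState_colState t s h3 hpm hpn hj hjp hi hip)
  rcases h with ⟨e, h⟩ | ⟨e, h⟩ | ⟨e, h⟩ | ⟨e, h⟩ <;>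
    rcases h' with ⟨e', h'⟩ | ⟨e', h'⟩ | ⟨e', h'⟩ | ⟨e', h'⟩ <;>
    rw [h, h'] <;> simp only [hrr, hcc, hrc, hcr] <;> split_ifs <;>
    first | omega | norm_num

theorem inner_psi_ket {p m n k a b : ℕ} (h3 : 3 ≤ p) (hpm : p ≤ m) (hpn : p ≤ n)
    (hk : 1 ≤ k) (hkp : k ≤ 4 * p - 4) (hab : (a, b) ∉ coveredCells p) :
    inner ℂ (psi m n p k) (tp (ket m a) (ket n b)) = 0 := by
  obtain ⟨i, hi, hip, h⟩ := psi_eq_rowState_or_colState m n p hk hkp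
  have := jf_bounds h3 hi hip
  rcases h with ⟨-, h⟩ | ⟨-, h⟩ | ⟨-, h⟩ | ⟨-, h⟩ <;> rw [h]
  · exact inner_rowState_ket _ hi hip (by omega) (by omega) hab
  · exact inner_colState_ket _ hi hip (by omega) (by omega) hab
  · exact inner_rowState_ket _ hi hip (by omega) (by omega) hab
  · exact inner_colState_ket _ hi hip (by omega) (by omega) hab

theorem four_p_minus_four_completable (p m n : ℕ) (h3 : 3 ≤ p) (hpm : p ≤ m) (hmn : m ≤ n) :
    ∃ χ : Fin (m * n - (4 * p - 4)) → EuclideanSpace ℂ (Fin m × Fin n),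
      (∀ t, ∃ (v : EuclideanSpace ℂ (Fin m)) (w : EuclideanSpace ℂ (Fin n)), χ t = tp v w) ∧
      Orthonormal ℂ (Sum.elim (fun k : Fin (4 * p - 4) => psi m n p ((k : ℕ) + 1)) χ) ∧
      Submodule.span ℂ
        (Set.range (Sum.elim (fun k : Fin (4 * p - 4) => psi m n p ((k : ℕ) + 1)) χ)) = ⊤ := by
  obtain ⟨c, hc⟩ := exists_uncovered_cells p m n
  have hpn := hpm.trans hmn
  have hon : Orthonormal ℂ (Sum.elim (fun k : Fin (4 * p - 4) => psi m n p ((k : ℕ) + 1))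
      fun t => tp (ket m (c t).1) (ket n (c t).2)) := by
    rw [orthonormal_iff_ite]
    rintro (k | t) (l | u) <;>
      simp only [Sum.elim_inl, Sum.elim_inr, Sum.inl.injEq, Sum.inr.injEq, reduceCtorEq, if_false]
    · rw [inner_psi_psi h3 hpm hpn (by omega) (by omega) (by omega) (by omega)]
      simp [Fin.ext_iff]
    · exact inner_psi_ket h3 hpm hpn (by omega) (by omega) (hc u)
    · exact inner_eq_zero_symm.1 (inner_psi_ket h3 hpm hpn (by omega) (by omega) (hc t))
    · rw [inner_tp, inner_ket _ _ (c t).1.2, inner_ket _ _ (c t).2.2, ite_zero_mul_ite_zero]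
      simp [← Fin.ext_iff, ← Prod.ext_iff]
  refine ⟨_, fun t => ⟨_, _, rfl⟩, hon, ?_⟩
  refine hon.linearIndependent.span_eq_top_of_card_eq_finrank' ?_
  have h1 : 4 * p - 4 ≤ p * p := by
    obtain ⟨q, rfl⟩ := Nat.exists_eq_add_of_le h3
    have : 4 * (3 + q) - 4 = 8 + 4 * q := by omega
    nlinarith
  have h2 : p * p ≤ m * n := Nat.mul_le_mul hpm hpn
  simp only [Fintype.card_sum, Fintype.card_fin, finrank_euclideanSpace, Fintype.card_prod]
  omega
end

section
/- If ⟨ψ_i, (B ⊗ I_n) ψ_j⟩ = 0 for all i, j with 1 ≤ i, j ≤ p−1 and i ≠ j, then the matrix entries satisfy B_{ij} = 0 for all 1 ≤ i, j ≤ p−1 with i ≠ j. -/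
open scoped ComplexInnerProductSpace Kronecker ComplexOrder

theorem act_kronecker_one_tp {m n : ℕ} (B : Matrix (Fin m) (Fin m) ℂ)
    (v : EuclideanSpace ℂ (Fin m)) (w : EuclideanSpace ℂ (Fin n)) :
    act (B ⊗ₖ (1 : Matrix (Fin n) (Fin n) ℂ)) (tp v w) = tp (Matrix.toEuclideanLin B v) w := by
  ext ⟨a, b⟩
  simp [act, tp, Matrix.toLpLin_apply, Matrix.mulVec, dotProduct, Fintype.sum_prod_type,
    Matrix.one_apply, Finset.sum_mul, mul_assoc]

theorem inner_tp_tp {m n : ℕ} (v v' : EuclideanSpace ℂ (Fin m))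
    (w w' : EuclideanSpace ℂ (Fin n)) : ⟪tp v w, tp v' w'⟫ = ⟪v, v'⟫ * ⟪w, w'⟫ := by
  simp only [PiLp.inner_apply, Fintype.sum_prod_type, Finset.sum_mul_sum]
  refine Finset.sum_congr rfl fun a _ => Finset.sum_congr rfl fun b _ => ?_
  simp [tp]
  ring

theorem ket_eq_single {m : ℕ} (a : Fin m) : ket m a = EuclideanSpace.single a 1 := by
  ext b
  simp [ket, Fin.val_inj]

theorem inner_ket_toEuclideanLin_ket {m : ℕ} (B : Matrix (Fin m) (Fin m) ℂ) (a b : Fin m) :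
    ⟪ket m a, Matrix.toEuclideanLin B (ket m b)⟫ = B a b := by
  simp [ket_eq_single, EuclideanSpace.inner_single_left, Matrix.toLpLin_apply]

theorem inner_ket_ket {n i j : ℕ} (hi : i < n) (hj : j < n) :
    ⟪ket n i, ket n j⟫ = if i = j then 1 else 0 := by
  lift i to Fin n using hi
  lift j to Fin n using hj
  simp [ket_eq_single, EuclideanSpace.inner_single_left, Fin.val_inj]

theorem invSqrt2_ne_zero : invSqrt2 ≠ 0 := by
  simp [invSqrt2]

theorem inner_smul_ket_sub_ket {n i j : ℕ} (hi : i < n) (hj : j < n) (hi0 : i ≠ 0)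
    (hj0 : j ≠ 0) (hij : i ≠ j) :
    ⟪invSqrt2 • (ket n 0 - ket n i), invSqrt2 • (ket n 0 - ket n j)⟫ ≠ 0 := by
  have h0 : 0 < n := by omega
  rw [inner_smul_left, inner_smul_right, inner_sub_left, inner_sub_right, inner_sub_right,
    inner_ket_ket h0 h0, inner_ket_ket h0 hj, inner_ket_ket hi h0, inner_ket_ket hi hj]
  simp [hi0, hj0.symm, hij, invSqrt2_ne_zero]

theorem offdiag_block_vanishes (p m n : ℕ) (h3 : 3 ≤ p) (hpm : p ≤ m) (hmn : m ≤ n)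
    (B : Matrix (Fin m) (Fin m) ℂ) (hB : B.PosSemidef)
    (h : ∀ i j : ℕ, 1 ≤ i → i ≤ p - 1 → 1 ≤ j → j ≤ p - 1 → i ≠ j →
      ⟪psi m n p i, act (B ⊗ₖ (1 : Matrix (Fin n) (Fin n) ℂ)) (psi m n p j)⟫ = 0) :
    ∀ a b : Fin m, 1 ≤ (a : ℕ) → (a : ℕ) ≤ p - 1 → 1 ≤ (b : ℕ) → (b : ℕ) ≤ p - 1 →
      (a : ℕ) ≠ (b : ℕ) → B a b = 0 := by
  intro a b ha hap hb hbp hab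
  have key := h a b ha hap hb hbp hab
  rw [psi, if_pos hap, psi, if_pos hbp, act_kronecker_one_tp, inner_tp_tp,
    inner_ket_toEuclideanLin_ket] at key
  exact (mul_eq_zero.mp key).resolve_right
    (inner_smul_ket_sub_ket (by omega) (by omega) (by omega) (by omega) hab)
end
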